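/- Let n ≥ 3 and w > 1. For each integer j with 3 ≤ j ≤ n there exists θ_j with (j−2)π/(n−1) ≤ θ_j ≤ jπ/(n+1) such that λ_j(w) = 2cos(θ_j). Moreover, for any such θ_j (necessarily θ_j ∈ (0, π), so sin θ_j ≠ 0), the squared first entry of a unit eigenvector of A(w) for λ_j(w) satisfies v_{1j}² = 2cos²((n−1)θ_j/2) / ( n + sin(nθ_j)/sin(θ_j) ) if j is odd, and v_{1j}² = 2sin²((n−1)θ_j/2) / ( n − sin(nθ_j)/sin(θ_j) ) if j is even. -/

import Mathlib

open Polynomial Real Filter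

noncomputable def pathA (n : ℕ) (w : ℝ) : Matrix (Fin n) (Fin n) ℝ :=
  Matrix.of fun i j =>
    if i = j ∧ (i.val = 0 ∨ i.val = n - 1) then w
    else if i.val + 1 = j.val ∨ j.val + 1 = i.val then 1
    else 0

/-- `μ` lists the eigenvalues of `pathA n w` with multiplicity, in decreasing order
(so `μ ⟨j-1,_⟩` is the `j`-th largest eigenvalue `λ_j(w)`). -/
def IsEigList (n : ℕ) (w : ℝ) (μ : Fin n → ℝ) : Prop :=
  Antitone μ ∧ (pathA n w).charpoly = ∏ i, (Polynomial.X - Polynomial.C (μ i))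

/-- The solution of the three-term recurrence of `pathA` at `x`, normalised to start at `1`. -/
noncomputable def pathSeq (w x : ℝ) : ℕ → ℝ
  | 0 => 1
  | 1 => x - w
  | k + 2 => x * pathSeq w x (k + 1) - pathSeq w x k

lemma pathA_mulVec_apply {n : ℕ} (w : ℝ) (v : Fin n → ℝ) (i : Fin n) :
    (pathA n w).mulVec v i =
      (if i.val = 0 ∨ i.val = n - 1 then w * v i else 0) +
      (if h : i.val + 1 < n then v ⟨i.val + 1, h⟩ else 0) +
      (if 0 < i.val then v ⟨i.val - 1, by omega⟩ else 0) := by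
  have key : ∀ k : Fin n, pathA n w i k * v k =
      (if k = i then (if i.val = 0 ∨ i.val = n - 1 then w * v i else 0) else 0) +
      (if i.val + 1 = k.val then v k else 0) + (if k.val + 1 = i.val then v k else 0) := by
    intro k
    by_cases h : k = i
    · subst h
      simp [pathA]
    · have h' : ¬ i = k := fun e => h e.symm
      by_cases h1 : i.val + 1 = k.val
      · have h2 : ¬ k.val + 1 = i.val := by omega
        simp [pathA, h, h', h1, h2]
      · by_cases h2 : k.val + 1 = i.val <;> simp [pathA, h, h', h1, h2]
  rw [Matrix.mulVec, dotProduct, Finset.sum_congr rfl fun k _ => key k,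
    Finset.sum_add_distrib, Finset.sum_add_distrib]
  congr 1
  · congr 1
    · simp
    · split_ifs with h
      · rw [Finset.sum_eq_single ⟨i.val + 1, h⟩]
        · simp
        · intro b _ hb
          rw [if_neg]
          intro e
          exact hb (Fin.ext e.symm)
        · simp
      · refine Finset.sum_eq_zero fun k _ => if_neg ?_
        have := k.2
        omega
  · split_ifs with h
    · rw [Finset.sum_eq_single ⟨i.val - 1, by omega⟩]
      · rw [if_pos]
        simp only
        omega
      · intro b _ hb
        rw [if_neg]
        intro e
        refine hb (Fin.ext ?_)
        simp only
        omega
      · simp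
    · refine Finset.sum_eq_zero fun k _ => if_neg ?_
      omega

lemma pathA_eigenvector_eq {n : ℕ} (hn : 2 ≤ n) {w x : ℝ} {v : Fin n → ℝ}
    (h : (pathA n w).mulVec v = x • v) (i : Fin n) :
    v i = v ⟨0, by omega⟩ * pathSeq w x i.val := by
  have H : ∀ k, (hk : k < n) → v ⟨k, hk⟩ = v ⟨0, by omega⟩ * pathSeq w x k := by
    intro k
    induction k using Nat.strong_induction_on with
    | _ k ih =>
      intro hk
      match k, ih, hk with
      | 0, _, _ => simp [pathSeq]
      | 1, _, hk =>
        have h0 := congrFun h ⟨0, by omega⟩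
        rw [pathA_mulVec_apply] at h0
        simp [hk] at h0
        simp only [pathSeq]
        linarith
      | k + 2, ih, hk =>
        have h0 := congrFun h ⟨k + 1, by omega⟩
        rw [pathA_mulVec_apply] at h0
        have e : ¬ (k + 1 = n - 1) := by omega
        have e' : k + 1 + 1 < n := by omega
        simp [e, e'] at h0
        rw [ih k (by omega) (by omega), ih (k + 1) (by omega) (by omega)] at h0
        simp only [pathSeq]
        linarith
  exact H i.val i.2

lemma exists_pathA_eigenvector_iff {n : ℕ} (hn : 2 ≤ n) {w x : ℝ} :
    (∃ v : Fin n → ℝ, v ≠ 0 ∧ (pathA n w).mulVec v = x • v) ↔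
      pathSeq w x n = w * pathSeq w x (n - 1) := by
  obtain ⟨m, rfl⟩ : ∃ m, n = m + 2 := ⟨n - 2, by omega⟩
  have hlast : pathSeq w x (m + 2) = x * pathSeq w x (m + 1) - pathSeq w x m := rfl
  constructor
  · rintro ⟨v, hv, h⟩
    have hs := pathA_eigenvector_eq hn h
    have hv0 : v ⟨0, by omega⟩ ≠ 0 := by
      intro h0
      refine hv (funext fun i => ?_)
      rw [hs i, h0, zero_mul, Pi.zero_apply]
    have h1 := congrFun h ⟨m + 1, by omega⟩
    rw [pathA_mulVec_apply] at h1
    simp only [Pi.smul_apply, smul_eq_mul] at h1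
    rw [if_pos (by simp), dif_neg (by simp), if_pos (by simp), hs ⟨m + 1, _⟩,
      hs ⟨m + 1 - 1, _⟩] at h1
    simp only [Nat.add_sub_cancel] at h1
    apply mul_left_cancel₀ hv0
    rw [hlast]
    simp only [Nat.add_succ_sub_one]
    linarith
  · intro h
    refine ⟨fun i => pathSeq w x i.val, ?_, ?_⟩
    · intro h0
      have := congrFun h0 ⟨0, by omega⟩
      simp [pathSeq] at this
    · funext i
      rw [pathA_mulVec_apply]
      obtain ⟨i, hi⟩ := i
      simp only [Pi.smul_apply, smul_eq_mul]
      rcases i with _ | i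
      · simp [pathSeq]
      · have e3 : pathSeq w x (i + 2) = x * pathSeq w x (i + 1) - pathSeq w x i := rfl
        by_cases hm : i = m
        · subst hm
          simp at h ⊢
          linarith
        · have e1 : i + 1 + 1 < m + 2 := by omega
          simp [hm, e1, e3]

lemma pathA_isRoot_charpoly_iff {n : ℕ} (hn : 2 ≤ n) {w x : ℝ} :
    (pathA n w).charpoly.IsRoot x ↔ pathSeq w x n = w * pathSeq w x (n - 1) := by
  rw [← exists_pathA_eigenvector_iff hn, Polynomial.IsRoot, Matrix.eval_charpoly,
    ← Matrix.exists_mulVec_eq_zero_iff]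
  simp only [Matrix.sub_mulVec, sub_eq_zero, Matrix.scalar_apply]
  refine exists_congr fun v => and_congr_right fun _ => ?_
  rw [← Matrix.smul_one_eq_diagonal, Matrix.smul_mulVec, Matrix.one_mulVec, eq_comm]

lemma pathA_isHermitian (n : ℕ) (w : ℝ) : (pathA n w).IsHermitian := by
  ext i j
  by_cases h : i = j
  · subst h
    rfl
  · have h' : ¬ j = i := fun e => h e.symm
    simp [pathA, h, h', or_comm]

lemma IsEigList.injective {n : ℕ} (hn : 2 ≤ n) {w : ℝ} {μ : Fin n → ℝ}
    (hμ : IsEigList n w μ) : Function.Injective μ := by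
  have hA := pathA_isHermitian n w
  have hinj : Function.Injective hA.eigenvalues := by
    intro i k hik
    by_contra hne
    have e1 := pathA_eigenvector_eq hn (hA.mulVec_eigenvectorBasis i)
    have e2 := pathA_eigenvector_eq hn (hA.mulVec_eigenvectorBasis k)
    rw [← hik] at e2
    have horth : inner ℝ (hA.eigenvectorBasis i) (hA.eigenvectorBasis k) = 0 :=
      hA.eigenvectorBasis.orthonormal.2 hne
    have n1 := hA.eigenvectorBasis.orthonormal.1 i
    have n2 := hA.eigenvectorBasis.orthonormal.1 k
    set a := hA.eigenvectorBasis i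
    set b := hA.eigenvectorBasis k
    have hab : b ⟨0, by omega⟩ • a = a ⟨0, by omega⟩ • b := by
      ext l
      simp only [PiLp.smul_apply, smul_eq_mul]
      rw [e1 l, e2 l]
      ring
    have hb0 : b ⟨0, by omega⟩ = 0 := by
      have := congrArg (fun z => inner ℝ a z) hab
      simpa [inner_smul_right, horth, n1] using this
    have : b = 0 := by
      ext l
      rw [e2 l, hb0]
      simp
    simp [this] at n2
  have hroots := hA.roots_charpoly_eq_eigenvalues
  rw [hμ.2] at hroots
  have hr2 : (∏ i, (Polynomial.X - Polynomial.C (μ i))).roots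
      = Multiset.map μ Finset.univ.val := by
    have := Polynomial.roots_multiset_prod_X_sub_C (Multiset.map μ Finset.univ.val)
    rwa [Multiset.map_map] at this
  rw [hr2] at hroots
  have hnd : (Multiset.map μ Finset.univ.val).Nodup := by
    rw [hroots]
    exact Multiset.Nodup.map (fun a b h => hinj (by simpa using h)) Finset.univ.nodup
  intro a b hab
  exact Multiset.inj_on_of_nodup_map hnd a (Finset.mem_univ a) b (Finset.mem_univ b) hab

lemma IsEigList.exists_eq_iff {n : ℕ} (hn : 2 ≤ n) {w : ℝ} {μ : Fin n → ℝ}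
    (hμ : IsEigList n w μ) (x : ℝ) :
    (∃ i, μ i = x) ↔ pathSeq w x n = w * pathSeq w x (n - 1) := by
  rw [← pathA_isRoot_charpoly_iff hn, hμ.2, Polynomial.IsRoot, Polynomial.eval_prod,
    Finset.prod_eq_zero_iff]
  simp only [Finset.mem_univ, true_and, Polynomial.eval_sub, Polynomial.eval_X,
    Polynomial.eval_C, sub_eq_zero]
  exact exists_congr fun i => eq_comm

lemma pathSeq_ne_of_le_neg_two {w x : ℝ} (hw : 1 < w) (hx : x ≤ -2) (k : ℕ) :
    pathSeq w x (k + 1) ≠ w * pathSeq w x k := by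
  have key : ∀ k, 0 < (-1) ^ k * pathSeq w x k ∧
      (-1) ^ k * pathSeq w x k ≤ (-1) ^ (k + 1) * pathSeq w x (k + 1) := by
    intro k
    induction k with
    | zero => simp [pathSeq]; linarith
    | succ k ih =>
      obtain ⟨h1, h2⟩ := ih
      refine ⟨h1.trans_le h2, ?_⟩
      have e : (-1 : ℝ) ^ (k + 2) * pathSeq w x (k + 2) =
          -x * ((-1) ^ (k + 1) * pathSeq w x (k + 1)) - (-1) ^ k * pathSeq w x k := by
        simp only [pathSeq]
        ring
      rw [e]
      nlinarith
  intro h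
  obtain ⟨h1, h2⟩ := key k
  rw [h, pow_succ] at h2
  nlinarith

/-- The phase shift with `tan (pathPhase w θ) = sin θ / (w - cos θ)`. -/
noncomputable def pathPhase (w θ : ℝ) : ℝ := arctan (sin θ / (w - cos θ))

lemma sub_cos_pos {w : ℝ} (hw : 1 < w) (θ : ℝ) : 0 < w - cos θ := by
  linarith [cos_le_one θ]

lemma pathPhase_relation {w : ℝ} (hw : 1 < w) (θ : ℝ) :
    w * sin (pathPhase w θ) = sin (θ + pathPhase w θ) := by
  have h1 := (sub_cos_pos hw θ).ne'
  have h2 : cos (pathPhase w θ) ≠ 0 := (cos_arctan_pos _).ne'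
  have h3 : tan (pathPhase w θ) = sin θ / (w - cos θ) := tan_arctan _
  rw [tan_eq_sin_div_cos, div_eq_div_iff h2 h1] at h3
  rw [sin_add]
  linarith

lemma pathPhase_lt_pi_div_two (w θ : ℝ) : pathPhase w θ < π / 2 := arctan_lt_pi_div_two _

lemma pathPhase_pos {w θ : ℝ} (hw : 1 < w) (h0 : 0 < θ) (hπ : θ < π) : 0 < pathPhase w θ :=
  arctan_pos.2 (div_pos (sin_pos_of_pos_of_lt_pi h0 hπ) (sub_cos_pos hw θ))

lemma sin_pathPhase_pos {w θ : ℝ} (hw : 1 < w) (h0 : 0 < θ) (hπ : θ < π) :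
    0 < sin (pathPhase w θ) :=
  sin_pos_of_pos_of_lt_pi (pathPhase_pos hw h0 hπ)
    (by linarith [pathPhase_lt_pi_div_two w θ, pi_pos])

lemma add_pathPhase_lt_pi {w θ : ℝ} (hw : 1 < w) (h0 : 0 < θ) (hπ : θ < π) :
    θ + pathPhase w θ < π := by
  by_contra! h
  have h1 : 0 < sin (θ + pathPhase w θ) := by
    rw [← pathPhase_relation hw]
    exact mul_pos (by linarith) (sin_pathPhase_pos hw h0 hπ)
  have h2 : 0 ≤ sin (θ + pathPhase w θ - π) :=
    sin_nonneg_of_nonneg_of_le_pi (by linarith)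
      (by linarith [pathPhase_lt_pi_div_two w θ, pi_pos])
  rw [sin_sub_pi] at h2
  linarith

lemma continuous_pathPhase {w : ℝ} (hw : 1 < w) : Continuous (pathPhase w) :=
  continuous_arctan.comp
    (continuous_sin.div (continuous_const.sub continuous_cos) fun θ => (sub_cos_pos hw θ).ne')

lemma hasDerivAt_pathPhase {w : ℝ} (hw : 1 < w) (θ : ℝ) :
    HasDerivAt (pathPhase w) ((w * cos θ - 1) / (w ^ 2 + 1 - 2 * (w * cos θ))) θ := by
  have h1 := (sub_cos_pos hw θ).ne'
  have h := ((hasDerivAt_sin θ).div ((hasDerivAt_cos θ).const_sub w) h1).arctan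
  refine h.congr_deriv ?_
  have h2 : w ^ 2 + 1 - 2 * (w * cos θ) = (w - cos θ) ^ 2 + sin θ ^ 2 := by
    rw [sin_sq]; ring
  have h3 : 0 < (w - cos θ) ^ 2 + sin θ ^ 2 := by positivity
  rw [h2]
  simp only [Pi.div_apply]
  field_simp
  rw [sin_sq]
  ring

lemma concaveOn_pathPhase {w : ℝ} (hw : 1 < w) : ConcaveOn ℝ (Set.Icc 0 π) (pathPhase w) := by
  refine AntitoneOn.concaveOn_of_deriv (convex_Icc 0 π) (continuous_pathPhase hw).continuousOn
    (fun θ _ => (hasDerivAt_pathPhase hw θ).differentiableAt.differentiableWithinAt) ?_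
  intro a ha b hb hab
  rw [interior_Icc] at ha hb
  rw [(hasDerivAt_pathPhase hw a).deriv, (hasDerivAt_pathPhase hw b).deriv]
  have hc : cos b ≤ cos a := cos_le_cos_of_nonneg_of_le_pi ha.1.le hb.2.le hab
  have hpos : ∀ t, 0 < w ^ 2 + 1 - 2 * (w * cos t) := fun t => by
    nlinarith [cos_le_one t]
  rw [div_le_div_iff₀ (hpos b) (hpos a)]
  nlinarith [mul_nonneg (mul_nonneg (by linarith : (0 : ℝ) ≤ w) (sub_nonneg.2 hc))
    (by nlinarith : (0 : ℝ) ≤ w ^ 2 - 1)]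

/-- `c * θ - pathPhase w θ` is convex and vanishes at `0`, so it is increasing once positive. -/
lemma sub_pathPhase_lt_of_lt {w c a b : ℝ} (hw : 1 < w) (h0 : 0 < a) (hab : a < b) (hb : b ≤ π)
    (ha : 0 < c * a - pathPhase w a) :
    c * a - pathPhase w a < c * b - pathPhase w b := by
  have hb0 : 0 < b := h0.trans hab
  have h := (concaveOn_pathPhase hw).2 (Set.left_mem_Icc.2 pi_pos.le) ⟨hb0.le, hb⟩
    (sub_nonneg.2 ((div_le_one hb0).2 hab.le)) (div_nonneg h0.le hb0.le) (sub_add_cancel 1 (a / b))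
  have hz : pathPhase w 0 = 0 := by simp [pathPhase]
  simp only [smul_eq_mul, hz, mul_zero, zero_add, div_mul_cancel₀ a hb0.ne'] at h
  have h2 : c * a - pathPhase w a ≤ a / b * (c * b - pathPhase w b) := by
    have : a / b * (c * b - pathPhase w b) = c * a - a / b * pathPhase w b := by
      field_simp
    linarith
  have h3 : a / b < 1 := (div_lt_one hb0).2 hab
  have h4 : 0 < a / b := by positivity
  have h5 : 0 < c * b - pathPhase w b := by
    by_contra! h6
    nlinarith [mul_nonneg h4.le (neg_nonneg.2 h6)]
  nlinarith

lemma pathSeq_two_mul_cos {w : ℝ} (hw : 1 < w) (θ : ℝ) (k : ℕ) :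
    pathSeq w (2 * cos θ) k * sin (pathPhase w θ) = sin (pathPhase w θ - k * θ) := by
  induction k using Nat.strong_induction_on with
  | _ k ih =>
    match k, ih with
    | 0, _ => simp [pathSeq]
    | 1, _ =>
      have h := pathPhase_relation hw θ
      rw [sin_add] at h
      simp only [pathSeq, Nat.cast_one, one_mul, sin_sub]
      linarith
    | k + 2, ih =>
      have e1 := ih k (by omega)
      have e2 := ih (k + 1) (by omega)
      have e : sin (pathPhase w θ - k * θ) + sin (pathPhase w θ - ((k + 2 : ℕ) : ℝ) * θ) =
          2 * cos θ * sin (pathPhase w θ - ((k + 1 : ℕ) : ℝ) * θ) := by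
        have a1 : pathPhase w θ - k * θ = pathPhase w θ - ((k + 1 : ℕ) : ℝ) * θ + θ := by
          push_cast; ring
        have a2 : pathPhase w θ - ((k + 2 : ℕ) : ℝ) * θ =
          pathPhase w θ - ((k + 1 : ℕ) : ℝ) * θ - θ := by
          push_cast; ring
        rw [a1, a2, sin_add _ θ, sin_sub _ θ]
        ring
      simp only [pathSeq]
      linear_combination 2 * cos θ * e2 - e1 - e

lemma pathSeq_two_mul_cos_eq_iff {w θ : ℝ} (hw : 1 < w) (h0 : 0 < θ) (hπ : θ < π) (k : ℕ) :
    pathSeq w (2 * cos θ) (k + 1) = w * pathSeq w (2 * cos θ) k ↔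
      ∃ m : ℤ, k / 2 * θ - pathPhase w θ = m * (π / 2) := by
  have hs := sin_pathPhase_pos hw h0 hπ
  have hθ := sin_pos_of_pos_of_lt_pi h0 hπ
  have e1 := pathSeq_two_mul_cos hw θ k
  have e2 := pathSeq_two_mul_cos hw θ (k + 1)
  have e3 := pathPhase_relation hw θ
  set p := pathPhase w θ
  set s := pathSeq w (2 * cos θ) k
  set s' := pathSeq w (2 * cos θ) (k + 1)
  have key : (s' - w * s) * (sin p * sin p) = sin θ * sin (k * θ - 2 * p) := by
    have a1 : p - ((k + 1 : ℕ) : ℝ) * θ = (p - k * θ) - θ := by push_cast; ring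
    have a2 : k * θ - 2 * p = -(p + (p - k * θ)) := by ring
    rw [a1, sin_sub] at e2
    rw [sin_add] at e3
    rw [a2, sin_neg, sin_add]
    linear_combination sin p * e2 - w * sin p * e1 - sin (p - k * θ) * e3
  have h1 : s' = w * s ↔ sin (k * θ - 2 * p) = 0 := by
    rw [← sub_eq_zero]
    constructor
    · intro h
      rw [h, zero_mul] at key
      exact (mul_eq_zero.1 key.symm).resolve_left hθ.ne'
    · intro h
      rw [h, mul_zero] at key
      exact (mul_eq_zero.1 key).resolve_right (mul_pos hs hs).ne'
  rw [h1, sin_eq_zero_iff]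
  refine exists_congr fun m => ⟨fun h => ?_, fun h => ?_⟩ <;> linarith

lemma two_mul_sin_mul_sum_cos (θ c : ℝ) (n : ℕ) :
    2 * sin θ * ∑ i ∈ Finset.range n, cos (2 * i * θ + c) =
      sin ((2 * n - 1) * θ + c) - sin (c - θ) := by
  induction n with
  | zero =>
    have : (2 * ((0 : ℕ) : ℝ) - 1) * θ + c = c - θ := by push_cast; ring
    rw [this]
    simp
  | succ n ih =>
    rw [Finset.sum_range_succ, mul_add, ih]
    have a1 : (2 * ((n + 1 : ℕ) : ℝ) - 1) * θ + c = (2 * n * θ + c) + θ := by push_cast; ring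
    have a2 : (2 * (n : ℝ) - 1) * θ + c = (2 * n * θ + c) - θ := by ring
    rw [a1, a2, sin_add _ θ, sin_sub _ θ]
    ring

lemma sin_mul_sum_sin_sq {n : ℕ} {θ p : ℝ} {m : ℕ}
    (hp : ((n : ℝ) - 1) / 2 * θ - p = m * (π / 2)) :
    2 * (sin θ * ∑ i ∈ Finset.range n, sin (p - i * θ) ^ 2) =
      n * sin θ - (-1) ^ m * sin (n * θ) := by
  have h : ∀ i : ℕ, sin (p - i * θ) ^ 2 =
      1 / 2 - (-1) ^ m / 2 * cos (2 * i * θ + -(((n : ℝ) - 1) * θ)) := by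
    intro i
    have e : 2 * (p - i * θ) = -((2 * i * θ + -(((n : ℝ) - 1) * θ)) + m * π) := by
      linear_combination (-2 : ℝ) * hp
    rw [sin_sq, cos_sq, e, cos_neg, cos_add_nat_mul_pi]
    ring
  have hs := two_mul_sin_mul_sum_cos θ (-(((n : ℝ) - 1) * θ)) n
  have a1 : (2 * (n : ℝ) - 1) * θ + -(((n : ℝ) - 1) * θ) = n * θ := by ring
  have a2 : -(((n : ℝ) - 1) * θ) - θ = -(n * θ) := by ring
  rw [a1, a2, sin_neg] at hs
  rw [Finset.sum_congr rfl fun i _ => h i, Finset.sum_sub_distrib, ← Finset.mul_sum]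
  simp only [Finset.sum_const, Finset.card_range, nsmul_eq_mul]
  linear_combination (-(-1) ^ m / 2) * hs

lemma sq_eq_of_pathA_eigenvector {n : ℕ} (hn : 2 ≤ n) {w θ : ℝ} (hw : 1 < w) (h0 : 0 < θ)
    (hπ : θ < π) {m : ℕ} (hm : ((n : ℝ) - 1) / 2 * θ - pathPhase w θ = m * (π / 2))
    {v : Fin n → ℝ} (hv : ∑ i, v i ^ 2 = 1)
    (h : (pathA n w).mulVec v = (2 * cos θ) • v) :
    v ⟨0, by omega⟩ ^ 2 =
      2 * sin (pathPhase w θ) ^ 2 / (n - (-1) ^ m * (sin (n * θ) / sin θ)) := by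
  have hs := sin_pathPhase_pos hw h0 hπ
  have hθ := sin_pos_of_pos_of_lt_pi h0 hπ
  have hsum : v ⟨0, by omega⟩ ^ 2 * ∑ i ∈ Finset.range n, sin (pathPhase w θ - i * θ) ^ 2 =
      sin (pathPhase w θ) ^ 2 := by
    rw [← one_mul (sin (pathPhase w θ) ^ 2), ← hv, Finset.mul_sum, Finset.sum_mul,
      Finset.sum_range]
    refine Finset.sum_congr rfl fun i _ => ?_
    rw [pathA_eigenvector_eq hn h i, ← pathSeq_two_mul_cos hw]
    ring
  have hS := sin_mul_sum_sin_sq hm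
  set S := ∑ i ∈ Finset.range n, sin (pathPhase w θ - i * θ) ^ 2
  have hS0 : S ≠ 0 := by
    intro e
    rw [e, mul_zero] at hsum
    exact (pow_pos hs 2).ne hsum
  have hden : n - (-1) ^ m * (sin (n * θ) / sin θ) = 2 * S := by
    field_simp
    linarith
  rw [hden, ← hsum]
  field_simp

lemma exists_pathPhase_eq {n : ℕ} (hn : 3 ≤ n) {w : ℝ} (hw : 1 < w) {j : ℕ} (hj3 : 3 ≤ j)
    (hjn : j ≤ n) :
    ∃ θ : ℝ, (((j : ℝ) - 2) * π / ((n : ℝ) - 1) ≤ θ ∧ θ ≤ (j : ℝ) * π / ((n : ℝ) + 1)) ∧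
      ((n : ℝ) - 1) / 2 * θ - pathPhase w θ = ((j : ℝ) - 2) * (π / 2) := by
  have hn' : (3 : ℝ) ≤ n := by exact_mod_cast hn
  have hj' : (3 : ℝ) ≤ j := by exact_mod_cast hj3
  have hjn' : (j : ℝ) ≤ n := by exact_mod_cast hjn
  have hπ := pi_pos
  set L := ((j : ℝ) - 2) * π / ((n : ℝ) - 1) with hL
  set R := (j : ℝ) * π / ((n : ℝ) + 1) with hR
  have hL0 : 0 < L := div_pos (mul_pos (by linarith) hπ) (by linarith)
  have hRπ : R < π := by
    rw [hR, div_lt_iff₀ (by linarith)]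
    nlinarith
  have hLR : L ≤ R := by
    rw [hL, hR, div_le_div_iff₀ (by linarith) (by linarith)]
    nlinarith
  have hLe : ((n : ℝ) - 1) / 2 * L = ((j : ℝ) - 2) * (π / 2) := by
    have : (n : ℝ) - 1 ≠ 0 := by linarith
    rw [hL]
    field_simp
  have hRe : ((n : ℝ) + 1) * R = j * π := by
    have : (n : ℝ) + 1 ≠ 0 := by linarith
    rw [hR]
    field_simp
  have hcont : ContinuousOn (fun θ => ((n : ℝ) - 1) / 2 * θ - pathPhase w θ) (Set.Icc L R) :=
    ((continuous_const.mul continuous_id).sub (continuous_pathPhase hw)).continuousOn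
  obtain ⟨θ, hθ, e⟩ := intermediate_value_Icc hLR hcont
    (show ((j : ℝ) - 2) * (π / 2) ∈ Set.Icc _ _ from
      ⟨by linarith [pathPhase_pos hw hL0 (hLR.trans_lt hRπ)],
        by linarith [add_pathPhase_lt_pi hw (hL0.trans_le hLR) hRπ]⟩)
  exact ⟨θ, hθ, e⟩

lemma pathA_angle_mem_Ioo {n : ℕ} {j : ℕ} (hj3 : 3 ≤ j) (hjn : j ≤ n) {θ : ℝ}
    (h1 : ((j : ℝ) - 2) * π / ((n : ℝ) - 1) ≤ θ) (h2 : θ ≤ (j : ℝ) * π / ((n : ℝ) + 1)) :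
    0 < θ ∧ θ < π := by
  have hj' : (3 : ℝ) ≤ j := by exact_mod_cast hj3
  have hjn' : (j : ℝ) ≤ n := by exact_mod_cast hjn
  constructor
  · exact (div_pos (mul_pos (by linarith) pi_pos) (by linarith)).trans_le h1
  · refine h2.trans_lt ?_
    rw [div_lt_iff₀ (by linarith)]
    nlinarith [pi_pos]

/-- The eigenvalues of `pathA n w` from the third one on, in terms of the solutions of the
phase equation. -/
lemma IsEigList.eq_two_mul_cos {n : ℕ} (hn : 3 ≤ n) {w : ℝ} (hw : 1 < w) {μ : Fin n → ℝ}
    (hμ : IsEigList n w μ) {Θ : ℕ → ℝ}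
    (hΘ : ∀ j, 3 ≤ j → j ≤ n → 0 < Θ j ∧ Θ j < π ∧
      ((n : ℝ) - 1) / 2 * Θ j - pathPhase w (Θ j) = ((j : ℝ) - 2) * (π / 2))
    {j : ℕ} (hj3 : 3 ≤ j) (hjn : j ≤ n) (hj : j - 1 < n) :
    μ ⟨j - 1, hj⟩ = 2 * cos (Θ j) := by
  have hinj := hμ.injective (by omega)
  have hanti : StrictAnti μ := hμ.1.strictAnti_of_injective hinj
  have hn1 : n - 1 + 1 = n := by omega
  have hcast : ((n - 1 : ℕ) : ℝ) = (n : ℝ) - 1 := by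
    rw [Nat.cast_sub (by omega)]
    simp
  have hlevel : ∀ j : ℕ, 3 ≤ j → (0 : ℝ) < ((j : ℝ) - 2) * (π / 2) := by
    intro j hj
    have : (3 : ℝ) ≤ j := by exact_mod_cast hj
    exact mul_pos (by linarith) (by linarith [pi_pos])
  have hlt : ∀ a b, 0 < a → a < b → b ≤ π → 0 < ((n : ℝ) - 1) / 2 * a - pathPhase w a →
      ((n : ℝ) - 1) / 2 * a - pathPhase w a < ((n : ℝ) - 1) / 2 * b - pathPhase w b :=
    fun a b h1 h2 h3 h4 => sub_pathPhase_lt_of_lt hw h1 h2 h3 h4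
  have hmono : ∀ j k : ℕ, 3 ≤ j → j < k → k ≤ n → Θ j < Θ k := by
    intro j k hj hjk hk
    obtain ⟨a1, a2, a3⟩ := hΘ j hj (by omega)
    obtain ⟨b1, b2, b3⟩ := hΘ k (by omega) hk
    have hjk' : (j : ℝ) < k := by exact_mod_cast hjk
    have hl : ((j : ℝ) - 2) * (π / 2) < ((k : ℝ) - 2) * (π / 2) :=
      mul_lt_mul_of_pos_right (by linarith) (by linarith [pi_pos])
    by_contra! hle
    rcases hle.eq_or_lt with he | hl'
    · rw [he] at b3
      linarith
    · have := hlt _ _ b1 hl' a2.le (by rw [b3]; exact hlevel k (by omega))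
      linarith
  have hroot : ∀ k, 3 ≤ k → k ≤ n → ∃ i, μ i = 2 * cos (Θ k) := by
    intro k hk hkn
    obtain ⟨b1, b2, b3⟩ := hΘ k hk hkn
    rw [hμ.exists_eq_iff (by omega)]
    have h := (pathSeq_two_mul_cos_eq_iff hw b1 b2 (n - 1)).2
      ⟨(k : ℤ) - 2, by rw [hcast, b3]; push_cast; ring⟩
    rwa [hn1] at h
  have hclass : ∀ i, μ i < 2 * cos (Θ j) → ∃ k, j < k ∧ k ≤ n ∧ μ i = 2 * cos (Θ k) := by
    intro i hi
    obtain ⟨a1, a2, a3⟩ := hΘ j hj3 hjn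
    have hrec := (hμ.exists_eq_iff (by omega) (μ i)).1 ⟨i, rfl⟩
    have hgt : -2 < μ i := by
      by_contra! hle
      refine pathSeq_ne_of_le_neg_two hw hle (n - 1) ?_
      rwa [hn1]
    have hlt2 : μ i < 2 := hi.trans_le (by linarith [cos_le_one (Θ j)])
    obtain ⟨θ, h0, hπ, hθ⟩ : ∃ θ, 0 < θ ∧ θ < π ∧ μ i = 2 * cos θ := by
      refine ⟨arccos (μ i / 2), arccos_pos.2 (by linarith), ?_, ?_⟩
      · refine lt_of_le_of_ne (arccos_le_pi _) fun e => ?_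
        rw [arccos_eq_pi] at e
        linarith
      · rw [cos_arccos (by linarith) (by linarith)]
        ring
    rw [hθ] at hrec hi
    have hjθ : Θ j < θ := by
      by_contra! hle
      have := cos_le_cos_of_nonneg_of_le_pi h0.le a2.le hle
      linarith
    have hrec' : pathSeq w (2 * cos θ) (n - 1 + 1) = w * pathSeq w (2 * cos θ) (n - 1) := by
      rwa [hn1]
    obtain ⟨m, hm⟩ := (pathSeq_two_mul_cos_eq_iff hw h0 hπ (n - 1)).1 hrec'
    rw [hcast] at hm
    have hgj := hlt _ _ a1 hjθ hπ.le (by rw [a3]; exact hlevel j hj3)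
    rw [a3, hm] at hgj
    have hjm : (j : ℝ) - 2 < m := lt_of_mul_lt_mul_right hgj (by linarith [pi_pos])
    have hjm' : (j : ℤ) - 2 < m := by exact_mod_cast hjm
    have hmn : (m : ℝ) < n - 1 := by
      have hp := pathPhase_pos hw h0 hπ
      have hn' : (3 : ℝ) ≤ n := by exact_mod_cast hn
      have : (m : ℝ) * (π / 2) < (n - 1) * (π / 2) := by nlinarith
      exact lt_of_mul_lt_mul_right this (by linarith [pi_pos])
    have hmn' : m < (n : ℤ) - 1 := by exact_mod_cast hmn
    obtain ⟨k, hk⟩ : ∃ k : ℕ, (k : ℤ) = m + 2 := ⟨(m + 2).toNat, by omega⟩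
    have hk' : (m : ℝ) = (k : ℝ) - 2 := by
      have : (k : ℝ) = (m : ℝ) + 2 := by exact_mod_cast hk
      linarith
    refine ⟨k, by omega, by omega, ?_⟩
    obtain ⟨b1, b2, b3⟩ := hΘ k (by omega) (by omega)
    have hl := hlevel k (by omega)
    rw [hk'] at hm
    rcases lt_trichotomy θ (Θ k) with h | h | h
    · have := hlt _ _ h0 h b2.le (by rw [hm]; exact hl)
      linarith
    · rw [hθ, h]
    · have := hlt _ _ b1 h hπ.le (by rw [b3]; exact hl)
      linarith
  obtain ⟨i, hi⟩ := hroot j hj3 hjn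
  have himage : (Finset.Ioi i).image μ = (Finset.Ioc j n).image fun k => 2 * cos (Θ k) := by
    ext x
    simp only [Finset.mem_image, Finset.mem_Ioi, Finset.mem_Ioc]
    constructor
    · rintro ⟨l, hl, rfl⟩
      obtain ⟨k, h1, h2, h3⟩ := hclass l (hi ▸ hanti hl)
      exact ⟨k, ⟨h1, h2⟩, h3.symm⟩
    · rintro ⟨k, ⟨h1, h2⟩, rfl⟩
      obtain ⟨l, hl⟩ := hroot k (by omega) h2
      refine ⟨l, hanti.lt_iff_gt.1 ?_, hl⟩
      rw [hl, hi]
      have := cos_lt_cos_of_nonneg_of_le_pi (hΘ j hj3 hjn).1.le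
        (hΘ k (by omega) h2).2.1.le (hmono j k hj3 h1 h2)
      linarith
  have hΘinj : Set.InjOn (fun k => 2 * cos (Θ k)) (Finset.Ioc j n : Set ℕ) := by
    intro a ha b hb hab
    simp only [Finset.coe_Ioc, Set.mem_Ioc] at ha hb
    have ha' := hΘ a (by omega) ha.2
    have hb' := hΘ b (by omega) hb.2
    have e : Θ a = Θ b := injOn_cos ⟨ha'.1.le, ha'.2.1.le⟩ ⟨hb'.1.le, hb'.2.1.le⟩
      (by simpa using hab)
    rcases lt_trichotomy a b with h | h | h
    · exact absurd e (hmono a b (by omega) h hb.2).ne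
    · exact h
    · exact absurd e (hmono b a (by omega) h ha.2).ne'
  have hcard := congrArg Finset.card himage
  rw [Finset.card_image_of_injective _ hinj, Finset.card_image_of_injOn hΘinj, Fin.card_Ioi,
    Nat.card_Ioc] at hcard
  rw [← hi]
  congr 1
  apply Fin.ext
  simp only
  have := i.2
  omega

/-- For `3 ≤ j ≤ n` there exists `θ_j ∈ [(j−2)π/(n−1), jπ/(n+1)]` with
`λ_j = 2cos θ_j`; moreover for any such `θ_j`, the squared first entry of a unit
`λ_j`-eigenvector is given by the stated trigonometric formulas. -/
theorem other_evals_and_evecs (n : ℕ) (hn : 3 ≤ n) (w : ℝ) (hw : 1 < w)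
    (μ : Fin n → ℝ) (hμ : IsEigList n w μ)
    (j : ℕ) (hj3 : 3 ≤ j) (hjn : j ≤ n) :
    (∃ θ : ℝ, ((j : ℝ) - 2) * π / ((n : ℝ) - 1) ≤ θ ∧ θ ≤ (j : ℝ) * π / ((n : ℝ) + 1) ∧
      μ ⟨j - 1, by omega⟩ = 2 * Real.cos θ) ∧
    (∀ θ : ℝ, ((j : ℝ) - 2) * π / ((n : ℝ) - 1) ≤ θ → θ ≤ (j : ℝ) * π / ((n : ℝ) + 1) →
      μ ⟨j - 1, by omega⟩ = 2 * Real.cos θ →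
      ∀ v : Fin n → ℝ, (∑ i, v i ^ 2 = 1) →
        (pathA n w).mulVec v = μ ⟨j - 1, by omega⟩ • v →
        (Odd j → v ⟨0, by omega⟩ ^ 2 =
          2 * Real.cos (((n : ℝ) - 1) / 2 * θ) ^ 2 /
            ((n : ℝ) + Real.sin ((n : ℝ) * θ) / Real.sin θ)) ∧
        (Even j → v ⟨0, by omega⟩ ^ 2 =
          2 * Real.sin (((n : ℝ) - 1) / 2 * θ) ^ 2 /
            ((n : ℝ) - Real.sin ((n : ℝ) * θ) / Real.sin θ))) := by
  have hex : ∀ k, ∃ θ : ℝ, 3 ≤ k → k ≤ n →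
      (((k : ℝ) - 2) * π / ((n : ℝ) - 1) ≤ θ ∧ θ ≤ (k : ℝ) * π / ((n : ℝ) + 1)) ∧
      ((n : ℝ) - 1) / 2 * θ - pathPhase w θ = ((k : ℝ) - 2) * (π / 2) := by
    intro k
    by_cases h : 3 ≤ k ∧ k ≤ n
    · obtain ⟨θ, hθ⟩ := exists_pathPhase_eq hn hw h.1 h.2
      exact ⟨θ, fun _ _ => hθ⟩
    · exact ⟨0, fun h1 h2 => absurd ⟨h1, h2⟩ h⟩
  choose Θ hΘ using hex
  have hmem : ∀ k, 3 ≤ k → k ≤ n → 0 < Θ k ∧ Θ k < π := fun k h1 h2 =>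
    pathA_angle_mem_Ioo h1 h2 (hΘ k h1 h2).1.1 (hΘ k h1 h2).1.2
  have hval : μ ⟨j - 1, by omega⟩ = 2 * cos (Θ j) :=
    hμ.eq_two_mul_cos hn hw
      (fun k h1 h2 => ⟨(hmem k h1 h2).1, (hmem k h1 h2).2, (hΘ k h1 h2).2⟩) hj3 hjn _
  obtain ⟨hIcc, hphase⟩ := hΘ j hj3 hjn
  refine ⟨⟨Θ j, hIcc.1, hIcc.2, hval⟩, ?_⟩
  intro θ hθ1 hθ2 hθ v hv hA
  obtain ⟨h0, hπ⟩ := pathA_angle_mem_Ioo hj3 hjn hθ1 hθ2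
  obtain ⟨h0', hπ'⟩ := hmem j hj3 hjn
  have heq : Θ j = θ := injOn_cos ⟨h0'.le, hπ'.le⟩ ⟨h0.le, hπ.le⟩ (by linarith)
  rw [heq] at hphase
  rw [hθ] at hA
  obtain ⟨m, rfl⟩ : ∃ m, j = m + 2 := ⟨j - 2, by omega⟩
  have hm : ((n : ℝ) - 1) / 2 * θ - pathPhase w θ = m * (π / 2) := by
    rw [hphase]
    push_cast
    ring
  have hmain := sq_eq_of_pathA_eigenvector (by omega) hw h0 hπ hm hv hA
  have hsin : sin (pathPhase w θ) ^ 2 = (1 - (-1) ^ m * cos (2 * (((n : ℝ) - 1) / 2 * θ))) / 2 := by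
    have e : 2 * pathPhase w θ = 2 * (((n : ℝ) - 1) / 2 * θ) - m * π := by
      linear_combination (-2 : ℝ) * hm
    rw [sin_sq, cos_sq, e, cos_sub_nat_mul_pi]
    ring
  constructor
  · intro hj
    have hodd : Odd m := by
      rw [Nat.odd_add] at hj
      exact hj.2 even_two
    rw [hmain, hsin, hodd.neg_one_pow, cos_sq]
    ring
  · intro hj
    have heven : Even m := by
      rw [Nat.even_add] at hj
      exact hj.2 even_two
    rw [hmain, hsin, heven.neg_one_pow, sin_sq, cos_sq (((n : ℝ) - 1) / 2 * θ)]
    ring
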